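/- For every t ∈ [0,1] and every 1 ≤ p < ∞ there exists an analytic f on 𝔻 such that f ∉ H^p (i.e. sup_{0≤r<1} ∫₀^{2π} |f(re^{iθ})|^p dθ = ∞) but C_t f ∈ H^p. That is, H^p is a proper subspace of the optimal domain [C_t, H^p] of the generalized Cesàro operator C_t. -/

import Mathlib

open Metric Real

/-- The generalized Cesàro operator
`(C_t f)(z) = (1/z)∫₀ᶻ f(ξ)/(1−tξ) dξ = ∫₀¹ f(sz)/(1−tsz) ds`. -/
noncomputable def cesaroT (t : ℝ) (f : ℂ → ℂ) (z : ℂ) : ℂ :=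
  ∫ s in (0:ℝ)..1, f ((s : ℂ) * z) / (1 - (t : ℂ) * (s : ℂ) * z)

/-- `f` belongs to the Hardy space `H^p`: `sup_{0≤r<1} ∫₀^{2π} |f(r e^{iθ})|^p dθ < ∞`. -/
def memHp (p : ℝ) (f : ℂ → ℂ) : Prop :=
  ∃ C : ℝ, ∀ r ∈ Set.Ico (0:ℝ) 1,
    (∫ θ in (0:ℝ)..(2 * π),
      (‖f ((r : ℂ) * Complex.exp ((θ : ℂ) * Complex.I))‖) ^ p) ≤ C

lemma re_one_add_pos {z : ℂ} (hz : z ∈ ball (0:ℂ) 1) : 0 < (1 + z).re := by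
  have h := (abs_le.1 (Complex.abs_re_le_norm z)).1
  have hz' : ‖z‖ < 1 := by simpa using hz
  simp only [Complex.add_re, Complex.one_re]
  linarith

lemma one_add_mem_slitPlane {z : ℂ} (hz : z ∈ ball (0:ℂ) 1) : 1 + z ∈ Complex.slitPlane :=
  Or.inl (re_one_add_pos hz)

lemma one_add_ne_zero_of_mem_ball {z : ℂ} (hz : z ∈ ball (0:ℂ) 1) : 1 + z ≠ 0 :=
  Complex.slitPlane_ne_zero (one_add_mem_slitPlane hz)

lemma norm_cpow_I {w : ℂ} (hw : w ≠ 0) : ‖w ^ Complex.I‖ = exp (-w.arg) := by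
  rw [Complex.norm_cpow_of_ne_zero hw]
  simp [Real.exp_neg]

lemma norm_cpow_I_le {w : ℂ} (hw : w ≠ 0) : ‖w ^ Complex.I‖ ≤ exp π := by
  rw [norm_cpow_I hw]
  exact exp_le_exp.2 (by linarith [Complex.neg_pi_lt_arg w])

lemma le_norm_cpow_I {w : ℂ} (hw : w ≠ 0) : exp (-π) ≤ ‖w ^ Complex.I‖ := by
  rw [norm_cpow_I hw]
  exact exp_le_exp.2 (by linarith [Complex.arg_le_pi w])

lemma mul_exp_mem_ball {r : ℝ} (hr : r ∈ Set.Ico (0:ℝ) 1) (θ : ℝ) :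
    (r : ℂ) * Complex.exp ((θ : ℂ) * Complex.I) ∈ ball (0:ℂ) 1 := by
  simp [Complex.norm_exp_ofReal_mul_I, abs_of_nonneg hr.1, hr.2]

/-- The function `(1 - tz) (z (1 + z)^i)'`, whose image under `C_t` is the bounded function
`(1 + z)^i`. -/
noncomputable def cesaroWitness (t : ℝ) (z : ℂ) : ℂ :=
  (1 - (t : ℂ) * z) * ((1 + z) ^ Complex.I * (1 + Complex.I * z / (1 + z)))

lemma differentiableOn_cesaroWitness (t : ℝ) :
    DifferentiableOn ℂ (cesaroWitness t) (ball (0:ℂ) 1) := by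
  intro z hz
  have h0 := one_add_ne_zero_of_mem_ball hz
  have hs := one_add_mem_slitPlane hz
  have h1 : DifferentiableAt ℂ (fun z : ℂ => (1 + z) ^ Complex.I) z :=
    (differentiableAt_id.const_add 1).cpow_const hs
  have h2 : DifferentiableAt ℂ (fun z : ℂ => Complex.I * z / (1 + z)) z :=
    DifferentiableAt.div (by fun_prop) (by fun_prop) h0
  have h3 : DifferentiableAt ℂ (fun z : ℂ => 1 - (t : ℂ) * z) z := by fun_prop
  exact (h3.mul (h1.mul (h2.const_add 1))).differentiableWithinAt

lemma cesaroT_cesaroWitness {t : ℝ} (ht : t ∈ Set.Icc (0:ℝ) 1) {z : ℂ}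
    (hz : z ∈ ball (0:ℂ) 1) : cesaroT t (cesaroWitness t) z = (1 + z) ^ Complex.I := by
  have hmem : ∀ s ∈ Set.Icc (0:ℝ) 1, (s : ℂ) * z ∈ ball (0:ℂ) 1 := by
    intro s hs
    have hz' : ‖z‖ < 1 := by simpa using hz
    simp only [mem_ball_zero_iff, norm_mul, Complex.norm_real, Real.norm_eq_abs,
      abs_of_nonneg hs.1]
    exact lt_of_le_of_lt (mul_le_of_le_one_left (norm_nonneg z) hs.2) hz'
  have hden : ∀ s ∈ Set.Icc (0:ℝ) 1, 1 - (t : ℂ) * ((s : ℂ) * z) ≠ 0 := by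
    intro s hs h
    have h1 : ‖(t : ℂ) * ((s : ℂ) * z)‖ < 1 := by
      have := hmem s hs
      rw [mem_ball_zero_iff] at this
      rw [norm_mul, Complex.norm_real, Real.norm_eq_abs, abs_of_nonneg ht.1]
      exact lt_of_le_of_lt (mul_le_of_le_one_left (norm_nonneg _) ht.2) this
    rw [← sub_eq_zero.1 h] at h1
    simp at h1
  have hint : cesaroT t (cesaroWitness t) z = ∫ s in (0:ℝ)..1,
      (1 + (s : ℂ) * z) ^ Complex.I * (1 + Complex.I * ((s : ℂ) * z) / (1 + (s : ℂ) * z)) := by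
    unfold cesaroT
    refine intervalIntegral.integral_congr fun s hs => ?_
    rw [Set.uIcc_of_le zero_le_one] at hs
    simp only [cesaroWitness]
    rw [mul_assoc (t : ℂ), mul_div_cancel_left₀ _ (hden s hs)]
  have hderiv : ∀ s ∈ Set.uIcc (0:ℝ) 1,
      HasDerivAt (fun s : ℝ => (s : ℂ) * (1 + (s : ℂ) * z) ^ Complex.I)
        ((1 + (s : ℂ) * z) ^ Complex.I *
          (1 + Complex.I * ((s : ℂ) * z) / (1 + (s : ℂ) * z))) s := by
    intro s hs
    rw [Set.uIcc_of_le zero_le_one] at hs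
    have h0 := one_add_ne_zero_of_mem_ball (hmem s hs)
    have hlin : HasDerivAt (fun w : ℂ => 1 + w * z) z (s : ℂ) := by
      simpa using ((hasDerivAt_id (s : ℂ)).mul_const z).const_add 1
    have hpow := hlin.cpow_const (c := Complex.I) (one_add_mem_slitPlane (hmem s hs))
    have := ((hasDerivAt_id (s : ℂ)).mul hpow).comp_ofReal
    refine this.congr_deriv ?_
    rw [Complex.cpow_sub _ _ h0, Complex.cpow_one, id]
    field_simp
  have hcont : ContinuousOn (fun s : ℝ => (1 + (s : ℂ) * z) ^ Complex.I *
      (1 + Complex.I * ((s : ℂ) * z) / (1 + (s : ℂ) * z))) (Set.uIcc (0:ℝ) 1) := by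
    rw [Set.uIcc_of_le zero_le_one]
    refine ContinuousOn.mul (ContinuousOn.cpow_const (by fun_prop)
      fun s hs => one_add_mem_slitPlane (hmem s hs)) ?_
    exact continuousOn_const.add (ContinuousOn.div (by fun_prop) (by fun_prop)
      fun s hs => one_add_ne_zero_of_mem_ball (hmem s hs))
  rw [hint, intervalIntegral.integral_eq_sub_of_hasDerivAt hderiv hcont.intervalIntegrable]
  simp

lemma memHp_of_bounded {p : ℝ} (hp : 0 ≤ p) {g : ℂ → ℂ} {B : ℝ}
    (hg : ∀ z ∈ ball (0:ℂ) 1, ‖g z‖ ≤ B) : memHp p g := by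
  refine ⟨B ^ p * |2 * π - 0|, fun r hr => le_trans (Real.le_norm_self _) ?_⟩
  refine intervalIntegral.norm_integral_le_of_norm_le_const fun θ _ => ?_
  rw [Real.norm_of_nonneg (by positivity)]
  exact rpow_le_rpow (norm_nonneg _) (hg _ (mul_exp_mem_ball hr θ)) hp

lemma le_norm_cesaroWitness {t : ℝ} (ht : 0 ≤ t) {z : ℂ} (hz : z ∈ ball (0:ℂ) 1)
    {d : ℝ} (hd : ‖1 + z‖ ≤ d) (hd' : d ≤ 1 / 4) :
    exp (-π) / 2 / d ≤ ‖cesaroWitness t z‖ := by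
  have h0 := one_add_ne_zero_of_mem_ball hz
  have hpos : 0 < ‖1 + z‖ := norm_pos_iff.2 h0
  have hre : z.re ≤ 0 := by
    have := (abs_le.1 (Complex.abs_re_le_norm (1 + z))).2
    simp only [Complex.add_re, Complex.one_re] at this
    linarith
  have h1 : 1 ≤ ‖1 - (t : ℂ) * z‖ := by
    refine le_trans ?_ (Complex.re_le_norm _)
    simp only [Complex.sub_re, Complex.one_re, Complex.re_ofReal_mul]
    nlinarith
  have h2 : 1 / 2 / d ≤ ‖1 + Complex.I * z / (1 + z)‖ := by
    have heq : 1 + Complex.I * z / (1 + z) =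
        ((1 + Complex.I) * (1 + z) - Complex.I) / (1 + z) := by
      field_simp
      ring
    rw [heq, norm_div]
    have hI : ‖(1 + Complex.I) * (1 + z)‖ ≤ 2 * ‖1 + z‖ := by
      rw [norm_mul]
      gcongr
      refine (norm_add_le _ _).trans ?_
      norm_num
    have hsub := norm_sub_norm_le Complex.I ((1 + Complex.I) * (1 + z))
    rw [norm_sub_rev, Complex.norm_I] at hsub
    exact div_le_div₀ (norm_nonneg _) (by linarith) hpos hd
  have h3 := le_norm_cpow_I h0
  have hd0 : 0 < d := hpos.trans_le hd
  rw [cesaroWitness, norm_mul, norm_mul]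
  calc exp (-π) / 2 / d = 1 * (exp (-π) * (1 / 2 / d)) := by ring
    _ ≤ _ := by gcongr

lemma norm_one_add_mul_exp_le {r : ℝ} (hr : r ∈ Set.Ico (0:ℝ) 1) {θ : ℝ} (hθ : π ≤ θ) :
    ‖1 + (r : ℂ) * Complex.exp ((θ : ℂ) * Complex.I)‖ ≤ (1 - r) + (θ - π) := by
  have hexp : Complex.exp ((θ : ℂ) * Complex.I) =
      -Complex.exp (Complex.I * ((θ - π : ℝ) : ℂ)) := by
    have : (θ : ℂ) * Complex.I = Complex.I * ((θ - π : ℝ) : ℂ) + π * Complex.I := by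
      push_cast
      ring
    rw [this, Complex.exp_add, Complex.exp_pi_mul_I]
    ring
  have hle := Real.norm_exp_I_mul_ofReal_sub_one_le (x := θ - π)
  rw [Real.norm_of_nonneg (by linarith)] at hle
  have heq : 1 + (r : ℂ) * Complex.exp ((θ : ℂ) * Complex.I) =
      ((1 - r : ℝ) : ℂ) - (r : ℂ) * (Complex.exp (Complex.I * ((θ - π : ℝ) : ℂ)) - 1) := by
    rw [hexp]
    push_cast
    ring
  rw [heq]
  refine (norm_sub_le _ _).trans ?_
  rw [norm_mul, Complex.norm_real, Complex.norm_real,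
    Real.norm_of_nonneg (by linarith [hr.2]), Real.norm_of_nonneg hr.1]
  have := mul_le_of_le_one_left (norm_nonneg
    (Complex.exp (Complex.I * ((θ - π : ℝ) : ℂ)) - 1)) hr.2.le
  linarith

lemma sub_one_le_rpow {x p : ℝ} (hx : 0 ≤ x) (hp : 1 ≤ p) : x - 1 ≤ x ^ p := by
  rcases le_total 1 x with h | h
  · linarith [self_le_rpow_of_one_le h hp]
  · linarith [rpow_nonneg hx p]

lemma le_integral_cesaroWitness {t p r : ℝ} (ht : 0 ≤ t) (hp : 1 ≤ p)
    (hr : r ∈ Set.Ico (7 / 8 : ℝ) 1) :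
    exp (-π) / 2 * log (1 / (8 * (1 - r))) - 1 / 8 ≤ ∫ θ in (0:ℝ)..(2 * π),
      ‖cesaroWitness t ((r : ℂ) * Complex.exp ((θ : ℂ) * Complex.I))‖ ^ p := by
  have hr' : r ∈ Set.Ico (0:ℝ) 1 := ⟨by linarith [hr.1], hr.2⟩
  have hε : 0 < 1 - r := by linarith [hr.2]
  have hcont : Continuous fun θ : ℝ =>
      ‖cesaroWitness t ((r : ℂ) * Complex.exp ((θ : ℂ) * Complex.I))‖ ^ p := by
    refine Continuous.rpow_const (Continuous.norm ?_) fun _ => Or.inr (by linarith)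
    exact (differentiableOn_cesaroWitness t).continuousOn.comp_continuous (by fun_prop)
      (mul_exp_mem_ball hr')
  have hne : ∀ θ ∈ Set.Icc π (π + 1 / 8), (1 - r) + (θ - π) ≠ 0 := fun θ hθ => by
    have := hθ.1
    positivity [sub_nonneg.2 this]
  have hlow : ContinuousOn (fun θ : ℝ => exp (-π) / 2 * ((1 - r) + (θ - π))⁻¹)
      (Set.uIcc π (π + 1 / 8)) := by
    rw [Set.uIcc_of_le (by linarith)]
    exact continuousOn_const.mul (ContinuousOn.inv₀ (by fun_prop) hne)
  have hval : ∫ θ in π..(π + 1 / 8), (exp (-π) / 2 * ((1 - r) + (θ - π))⁻¹ - 1) =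
      exp (-π) / 2 * log ((1 - r + 1 / 8) / (1 - r)) - 1 / 8 := by
    rw [intervalIntegral.integral_sub hlow.intervalIntegrable intervalIntegrable_const,
      intervalIntegral.integral_const_mul]
    have hshift := intervalIntegral.integral_comp_add_right (a := π) (b := π + 1 / 8)
      (fun x : ℝ => x⁻¹) (1 - r - π)
    have hfun : (fun θ : ℝ => ((1 - r) + (θ - π))⁻¹) = fun θ : ℝ => (θ + (1 - r - π))⁻¹ := by
      funext θ
      congr 1
      ring
    rw [hfun, hshift, integral_inv_of_pos (by linarith) (by linarith)]
    simp only [intervalIntegral.integral_const, smul_eq_mul]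
    ring_nf
  calc exp (-π) / 2 * log (1 / (8 * (1 - r))) - 1 / 8
      ≤ exp (-π) / 2 * log ((1 - r + 1 / 8) / (1 - r)) - 1 / 8 := by
        have : 1 / (8 * (1 - r)) ≤ (1 - r + 1 / 8) / (1 - r) := by
          rw [← div_div]
          gcongr
          linarith
        gcongr
    _ = ∫ θ in π..(π + 1 / 8), (exp (-π) / 2 * ((1 - r) + (θ - π))⁻¹ - 1) := hval.symm
    _ ≤ ∫ θ in π..(π + 1 / 8),
        ‖cesaroWitness t ((r : ℂ) * Complex.exp ((θ : ℂ) * Complex.I))‖ ^ p := by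
        refine intervalIntegral.integral_mono_on (by linarith)
          (hlow.intervalIntegrable.sub intervalIntegrable_const)
          (hcont.intervalIntegrable _ _) fun θ hθ => ?_
        have hle := le_norm_cesaroWitness ht (mul_exp_mem_ball hr' θ)
          (norm_one_add_mul_exp_le hr' hθ.1) (by linarith [hr.1, hθ.2])
        rw [div_eq_mul_inv _ ((1 - r) + (θ - π))] at hle
        linarith [sub_one_le_rpow (norm_nonneg
          (cesaroWitness t ((r : ℂ) * Complex.exp ((θ : ℂ) * Complex.I)))) hp]
    _ ≤ _ := by
        refine intervalIntegral.integral_mono_interval pi_pos.le (by linarith)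
          (by linarith [pi_gt_three]) (Filter.Eventually.of_forall fun θ => ?_)
          (hcont.intervalIntegrable _ _)
        exact rpow_nonneg (norm_nonneg _) p

lemma not_memHp_cesaroWitness {t p : ℝ} (ht : 0 ≤ t) (hp : 1 ≤ p) :
    ¬ memHp p (cesaroWitness t) := by
  rintro ⟨C, hC⟩
  obtain ⟨M, hM⟩ : ∃ M : ℝ, M = (|C| + 1) / (exp (-π) / 2) := ⟨_, rfl⟩
  have hM0 : 0 ≤ M := by rw [hM]; positivity
  have hexp : exp (-M) ≤ 1 := exp_le_one_iff.2 (by linarith)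
  have hpos := exp_pos (-M)
  have hr : 1 - exp (-M) / 8 ∈ Set.Ico (7 / 8 : ℝ) 1 := ⟨by linarith, by linarith⟩
  have hlow := le_integral_cesaroWitness ht hp hr
  have hup := hC (1 - exp (-M) / 8) ⟨by linarith, by linarith⟩
  have hlog : log (1 / (8 * (1 - (1 - exp (-M) / 8)))) = M := by
    have : 8 * (1 - (1 - exp (-M) / 8)) = exp (-M) := by ring
    rw [this, one_div, log_inv, log_exp, neg_neg]
  have hmul : exp (-π) / 2 * M = |C| + 1 := by
    rw [hM, mul_div_cancel₀ _ (by positivity)]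
  rw [hlog, hmul] at hlow
  linarith [le_abs_self C]

/-- For every `t ∈ [0,1]` and every `1 ≤ p < ∞` there is an analytic `f` on
`𝔻` with `f ∉ H^p` but `C_t f ∈ H^p`; that is, `H^p` is a proper subspace of the optimal
domain `[C_t, H^p]`. -/
theorem Hp_properSubset_optimalDomain_cesaroT
    (t : ℝ) (ht : t ∈ Set.Icc (0:ℝ) 1) (p : ℝ) (hp : 1 ≤ p) :
    ∃ f : ℂ → ℂ, DifferentiableOn ℂ f (ball (0:ℂ) 1) ∧
      ¬ memHp p f ∧ memHp p (cesaroT t f) := by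
  refine ⟨cesaroWitness t, differentiableOn_cesaroWitness t, not_memHp_cesaroWitness ht.1 hp,
    memHp_of_bounded (B := exp π) (by linarith) fun z hz => ?_⟩
  rw [cesaroT_cesaroWitness ht hz]
  exact norm_cpow_I_le (one_add_ne_zero_of_mem_ball hz)
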